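/- Fix n ≥ 3 and let ℓ_{ξ,v} = {(v′ − t²ξ′, arctan(v_{n−1}/t) − tξ_{n−1}, t) : |t − 1| ≤ 1/10} be the φ_{n,tan}-curves, with base point p₀ = (0,0,1) ∈ ℝ^{n−2} × ℝ × ℝ. Then for every ε₀ > 0 the following configuration does not exist: a smooth diffeomorphism F from the open ball B_{ε₀}(p₀) ⊂ ℝⁿ onto its image, maps Ξ, V : ℝ^{n−1} × ℝ^{n−1} → ℝ^{n−1}, a constant C > 0, and a neighborhood U of (0,0) in ℝ^{n−1} × ℝ^{n−1}, such that for every (ξ,v) ∈ U, every point of F(ℓ_{ξ,v} ∩ B_{ε₀}(p₀)) lies within distance C·|(ξ,v)|⁴ of the line line_{Ξ(ξ,v), V(ξ,v)}. -/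

import Mathlib

open Metric Set Topology MeasureTheory

noncomputable section

/-- ξ-gradient ∇_ξφ(x,ξ). -/
def gradXi (n : ℕ) (φ : (Fin n → ℝ) → (Fin (n-1) → ℝ) → ℝ)
    (x : Fin n → ℝ) (ξ : Fin (n-1) → ℝ) : Fin (n-1) → ℝ :=
  fun j => fderiv ℝ (φ x) ξ (Pi.single j (1:ℝ))

/-- ξ-Hessian ∇_ξ²φ(x,ξ). -/
def hessXi (n : ℕ) (φ : (Fin n → ℝ) → (Fin (n-1) → ℝ) → ℝ)
    (x : Fin n → ℝ) (ξ : Fin (n-1) → ℝ) : Matrix (Fin (n-1)) (Fin (n-1)) ℝ :=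
  Matrix.of fun i j => fderiv ℝ (fun η => gradXi n φ x η i) ξ (Pi.single j (1:ℝ))

/-- Mixed Hessian ∇_x∇_ξφ(x,ξ) : entry (i,j) is ∂_{x_i}∂_{ξ_j}φ. -/
def mixedHess (n : ℕ) (φ : (Fin n → ℝ) → (Fin (n-1) → ℝ) → ℝ)
    (x : Fin n → ℝ) (ξ : Fin (n-1) → ℝ) : Matrix (Fin n) (Fin (n-1)) ℝ :=
  Matrix.of fun i j => fderiv ℝ (fun y => gradXi n φ y ξ j) x (Pi.single i (1:ℝ))

/-- Gauss map: G(x,ξ)ᵢ = det(∂_{ξ_1}∇_xφ, …, ∂_{ξ_{n-1}}∇_xφ, eᵢ), so that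
⟨G(x,ξ), w⟩ = det(∂_{ξ_1}∇_xφ, …, ∂_{ξ_{n-1}}∇_xφ, w) for all w. -/
def gaussMap (n : ℕ) (φ : (Fin n → ℝ) → (Fin (n-1) → ℝ) → ℝ)
    (x : Fin n → ℝ) (ξ : Fin (n-1) → ℝ) : Fin n → ℝ :=
  fun i => Matrix.det (Matrix.of fun a b : Fin n =>
    if h : (b : ℕ) < n - 1 then mixedHess n φ x ξ a ⟨(b : ℕ), h⟩
    else (Pi.single i (1:ℝ) : Fin n → ℝ) a)

/-- Directional derivative (G(x,ξ)·∇_x) f at x. -/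
def GD (n : ℕ) (φ : (Fin n → ℝ) → (Fin (n-1) → ℝ) → ℝ)
    (f : (Fin n → ℝ) → ℝ) (ξ : Fin (n-1) → ℝ) (x : Fin n → ℝ) : ℝ :=
  fderiv ℝ f x (gaussMap n φ x ξ)

/-- The matrix (G(x,ξ)·∇_x)∇_ξ²φ(x,ξ). -/
def GDhess (n : ℕ) (φ : (Fin n → ℝ) → (Fin (n-1) → ℝ) → ℝ)
    (x : Fin n → ℝ) (ξ : Fin (n-1) → ℝ) : Matrix (Fin (n-1)) (Fin (n-1)) ℝ :=
  Matrix.of fun i j => GD n φ (fun y => hessXi n φ y ξ i j) ξ x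

/-- The matrix (G(x,ξ)·∇_x)²∇_ξ²φ(x,ξ). -/
def GD2hess (n : ℕ) (φ : (Fin n → ℝ) → (Fin (n-1) → ℝ) → ℝ)
    (x : Fin n → ℝ) (ξ : Fin (n-1) → ℝ) : Matrix (Fin (n-1)) (Fin (n-1)) ℝ :=
  Matrix.of fun i j => GD n φ (fun y => GD n φ (fun z => hessXi n φ z ξ i j) ξ y) ξ x

/-- Bourgain's condition on M × Σ. -/
def BourgainCond (n : ℕ) (φ : (Fin n → ℝ) → (Fin (n-1) → ℝ) → ℝ)
    (M : Set (Fin n → ℝ)) (Ω : Set (Fin (n-1) → ℝ)) : Prop :=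
  ∃ lam : (Fin n → ℝ) → (Fin (n-1) → ℝ) → ℝ,
    ∀ x ∈ M, ∀ ξ ∈ Ω, GD2hess n φ x ξ = lam x ξ • GDhess n φ x ξ

/-- Hörmander-type phase function: smooth, (H1) and (H2) on M × Σ. -/
def IsHormander (n : ℕ) (φ : (Fin n → ℝ) → (Fin (n-1) → ℝ) → ℝ)
    (M : Set (Fin n → ℝ)) (Ω : Set (Fin (n-1) → ℝ)) : Prop :=
  ContDiffOn ℝ (⊤ : ℕ∞) (fun q : (Fin n → ℝ) × (Fin (n-1) → ℝ) => φ q.1 q.2) (M ×ˢ Ω) ∧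
  (∀ x ∈ M, ∀ ξ ∈ Ω, (mixedHess n φ x ξ).rank = n - 1) ∧
  (∀ x ∈ M, ∀ ξ ∈ Ω, (GDhess n φ x ξ).det ≠ 0)

/-- The point (x̄, t) ∈ ℝⁿ. -/
def toPt (n : ℕ) (xb : Fin (n-1) → ℝ) (t : ℝ) : Fin n → ℝ :=
  fun i => if h : (i : ℕ) < n - 1 then xb ⟨(i : ℕ), h⟩ else t

/-- line_{ξ,v} = {(v,0) − s(ξ,1) : s ∈ ℝ} ⊆ ℝⁿ. -/
def lineSet (n : ℕ) (ξ v : Fin (n-1) → ℝ) : Set (Fin n → ℝ) :=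
  {p | ∃ s : ℝ, p = toPt n v 0 - s • toPt n ξ 1}

end

noncomputable section

/-- The tan-example phase function in ℝⁿ with n = m+3.  Coordinates:
x = (x′, x_{n-1}, t) with x′ = (x 0, …, x m), x_{n-1} = x (m+1), t = x (m+2);
ξ = (ξ′, ξ_{n-1}) with ξ′ = (ξ 0, …, ξ m), ξ_{n-1} = ξ (m+1).
φ(x,ξ) = x′·ξ′ + ½ t² |ξ′|² + log (sec (t ξ_{n-1} + x_{n-1})). -/
def φtan (m : ℕ) (x : Fin (m+3) → ℝ) (ξ : Fin (m+2) → ℝ) : ℝ :=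
  (∑ i : Fin (m+1), x (Fin.castLE (by omega) i) * ξ (Fin.castLE (by omega) i))
  + (1/2) * (x ⟨m+2, by omega⟩)^2 * (∑ i : Fin (m+1), (ξ (Fin.castLE (by omega) i))^2)
  + Real.log ((Real.cos (x ⟨m+2, by omega⟩ * ξ ⟨m+1, by omega⟩ + x ⟨m+1, by omega⟩))⁻¹)

/-- The unique solution x̄ of ∇_ξφ_{n,tan}((x̄,t),ξ) = v:
x′ = v′ − t²ξ′ and x_{n-1} = arctan(v_{n-1}/t) − t ξ_{n-1}. -/
def xsolTan (m : ℕ) (ξ v : Fin (m+2) → ℝ) (t : ℝ) : Fin (m+2) → ℝ :=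
  fun i => if (i : ℕ) < m+1 then v i - t^2 * ξ i
    else Real.arctan (v ⟨m+1, by omega⟩ / t) - t * ξ ⟨m+1, by omega⟩

/-- The φ_{n,tan}-curve ℓ_{ξ,v} = {(v′−t²ξ′, arctan(v_{n-1}/t) − tξ_{n-1}, t) : |t−1| ≤ 1/10}. -/
def ellTan (m : ℕ) (ξ v : Fin (m+2) → ℝ) : Set (Fin (m+3) → ℝ) :=
  {x | ∃ t : ℝ, |t - 1| ≤ 1/10 ∧ x = toPt (m+3) (xsolTan m ξ v t) t}

open Filter Asymptotics
open scoped ContDiff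

/-- Integrals over `[0, 1]` of smooth functions depending on a parameter are smooth. -/
theorem contDiff_intervalIntegral_param {X : Type} [NormedAddCommGroup X] [NormedSpace ℝ X]
    [FiniteDimensional ℝ X] (k : ℕ) {E : Type} [NormedAddCommGroup E] [NormedSpace ℝ E]
    [CompleteSpace E] {f : X × ℝ → E} (hf : ContDiff ℝ ∞ f) :
    ContDiff ℝ k (fun x => ∫ s in (0:ℝ)..1, f (x, s)) := by
  induction k generalizing E with
  | zero =>
    refine contDiff_zero.2 ?_
    exact intervalIntegral.continuous_parametric_intervalIntegral_of_continuous'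
      (f := fun x s => f (x, s)) hf.continuous 0 1
  | succ k ih =>
    have hf' : ContDiff ℝ ∞ (fun z : X × ℝ =>
        (fderiv ℝ f z).comp (ContinuousLinearMap.inl ℝ X ℝ)) :=
      (hf.fderiv_right (m := ∞) (by simp)).clm_comp contDiff_const
    refine contDiff_succ_iff_hasFDerivAt.2 ⟨_, ih hf', fun x => ?_⟩
    have : ProperSpace X := FiniteDimensional.proper ℝ X
    obtain ⟨C, hC⟩ := ((isCompact_closedBall x 1).prod
      (isCompact_Icc (a := (0:ℝ)) (b := 1))).exists_bound_of_continuousOn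
        hf'.continuous.continuousOn
    refine (intervalIntegral.hasFDerivAt_integral_of_dominated_of_fderiv_le
      (F := fun x s => f (x, s))
      (F' := fun x s => (fderiv ℝ f (x, s)).comp (ContinuousLinearMap.inl ℝ X ℝ))
      (bound := fun _ => C) (ball_mem_nhds x one_pos) ?_ ?_ ?_ ?_ ?_ ?_)
    · exact Eventually.of_forall fun y =>
        (hf.continuous.comp (by fun_prop : Continuous fun s : ℝ => (y, s))).aestronglyMeasurable
    · exact (hf.continuous.comp
        (by fun_prop : Continuous fun s : ℝ => (x, s))).intervalIntegrable _ _
    · exact (hf'.continuous.comp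
        (by fun_prop : Continuous fun s : ℝ => (x, s))).aestronglyMeasurable
    · refine Eventually.of_forall fun s hs y hy => hC (y, s) ⟨ball_subset_closedBall hy, ?_⟩
      rw [uIoc_of_le zero_le_one] at hs
      exact Ioc_subset_Icc_self hs
    · exact intervalIntegrable_const
    · refine Eventually.of_forall fun s hs y hy => ?_
      exact ((hf.differentiable (by simp) (y, s)).hasFDerivAt).comp y (hasFDerivAt_prodMk_left y s)

/-- Hadamard's lemma in the first variable. -/
theorem ContDiff.exists_eq_add_fst_mul {f : ℝ × ℝ → ℝ} (hf : ContDiff ℝ ∞ f) :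
    ∃ g : ℝ × ℝ → ℝ, ContDiff ℝ ∞ g ∧ ∀ x y, f (x, y) = f (0, y) + x * g (x, y) := by
  have hd : ContDiff ℝ ∞ (fderiv ℝ f) := hf.fderiv_right (by simp)
  have hF : ContDiff ℝ ∞ (fun w : (ℝ × ℝ) × ℝ =>
      fderiv ℝ f (w.2 * w.1.1, w.1.2) ((1 : ℝ), (0 : ℝ))) := by fun_prop
  refine ⟨fun z => ∫ s in (0:ℝ)..1, fderiv ℝ f (s * z.1, z.2) ((1 : ℝ), (0 : ℝ)),
    contDiff_infty.2 fun k => contDiff_intervalIntegral_param k hF, fun x y => ?_⟩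
  have key : ∀ s ∈ uIcc (0:ℝ) 1, HasDerivAt (fun s => f (s * x, y))
      (x * fderiv ℝ f (s * x, y) ((1 : ℝ), (0 : ℝ))) s := by
    intro s _
    have h1 : HasDerivAt (fun s : ℝ => (s * x, y)) (x, (0:ℝ)) s := by
      simpa using ((hasDerivAt_id s).mul_const x).prodMk (hasDerivAt_const s y)
    have h2 := (hf.differentiable (by simp) (s * x, y)).hasFDerivAt.comp_hasDerivAt s h1
    have h3 : ((x, (0:ℝ)) : ℝ × ℝ) = x • ((1 : ℝ), (0 : ℝ)) := by simp
    rw [h3, map_smul, smul_eq_mul] at h2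
    exact h2
  have hc : Continuous fun s : ℝ => x * fderiv ℝ f (s * x, y) ((1 : ℝ), (0 : ℝ)) := by
    have := hd.continuous
    fun_prop
  have h := intervalIntegral.integral_eq_sub_of_hasDerivAt key (hc.intervalIntegrable _ _)
  rw [intervalIntegral.integral_const_mul] at h
  simp only [one_mul, zero_mul] at h
  linarith

/-- Hadamard's lemma in the second variable. -/
theorem ContDiff.exists_eq_add_snd_mul {f : ℝ × ℝ → ℝ} (hf : ContDiff ℝ ∞ f) :
    ∃ g : ℝ × ℝ → ℝ, ContDiff ℝ ∞ g ∧ ∀ x y, f (x, y) = f (x, 0) + y * g (x, y) := by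
  obtain ⟨g, hg, h⟩ := ContDiff.exists_eq_add_fst_mul
    (f := fun z => f (z.2, z.1)) (by fun_prop)
  exact ⟨fun z => g (z.2, z.1), by fun_prop, fun x y => h y x⟩

/-- Second order expansion in the second variable. -/
theorem ContDiff.exists_taylor_snd {f : ℝ × ℝ → ℝ} (hf : ContDiff ℝ ∞ f) :
    ∃ (p q : ℝ → ℝ) (r : ℝ × ℝ → ℝ), ContDiff ℝ ∞ p ∧ ContDiff ℝ ∞ q ∧ ContDiff ℝ ∞ r ∧
      ∀ x y, f (x, y) = f (x, 0) + y * p x + y ^ 2 * q x + y ^ 3 * r (x, y) := by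
  obtain ⟨g₁, hg₁, h₁⟩ := hf.exists_eq_add_snd_mul
  obtain ⟨g₂, hg₂, h₂⟩ := hg₁.exists_eq_add_snd_mul
  obtain ⟨g₃, hg₃, h₃⟩ := hg₂.exists_eq_add_snd_mul
  refine ⟨fun x => g₁ (x, 0), fun x => g₂ (x, 0), g₃, by fun_prop, by fun_prop, hg₃,
    fun x y => ?_⟩
  rw [h₁, h₂, h₃]
  ring

/-- The coefficients of a second order expansion are given by derivatives. -/
theorem deriv_of_taylor {φ r : ℝ → ℝ} {c p q : ℝ} (hr : ContDiff ℝ ∞ r)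
    (h : ∀ y, φ y = c + y * p + y ^ 2 * q + y ^ 3 * r y) {φ₁ : ℝ → ℝ} {φ₂ : ℝ}
    (h₁ : ∀ y, HasDerivAt φ (φ₁ y) y) (h₂ : HasDerivAt φ₁ φ₂ 0) :
    φ₁ 0 = p ∧ φ₂ = 2 * q := by
  have hr' : ∀ y, HasDerivAt r (deriv r y) y := fun y =>
    (hr.differentiable (by simp) y).hasDerivAt
  have hr2 : HasDerivAt (deriv r) (deriv (deriv r) 0) 0 :=
    (((contDiff_infty_iff_deriv.1 hr).2).differentiable (by simp) 0).hasDerivAt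
  have e₁ : ∀ y, φ₁ y = p + 2 * y * q + 3 * y ^ 2 * r y + y ^ 3 * deriv r y := by
    intro y
    have hd : HasDerivAt φ (p + 2 * y * q + 3 * y ^ 2 * r y + y ^ 3 * deriv r y) y := by
      rw [funext h]
      refine (((((hasDerivAt_id y).mul_const p).const_add c).add
        (((hasDerivAt_id y).pow 2).mul_const q)).add
        (((hasDerivAt_id y).pow 3).mul (hr' y))).congr_deriv ?_
      simp
      ring
    exact (h₁ y).unique hd
  refine ⟨by simp [e₁], h₂.unique ?_⟩
  rw [funext e₁]
  refine ((((((hasDerivAt_id (0:ℝ)).const_mul 2).mul_const q).const_add p).add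
    ((((hasDerivAt_id (0:ℝ)).pow 2).const_mul 3).mul (hr' 0))).add
    (((hasDerivAt_id (0:ℝ)).pow 3).mul hr2)).congr_deriv ?_
  simp

theorem ContinuousAt.eq_zero_of_isBigO_pow {P : ℝ → ℝ} {n : ℕ} (hP : ContinuousAt P 0)
    (h : P =O[𝓝[≠] 0] fun x : ℝ => x ^ (n + 1)) : P 0 = 0 := by
  have h1 : Tendsto (fun x : ℝ => x ^ (n + 1)) (𝓝[≠] 0) (𝓝 0) := by
    have : ContinuousAt (fun x : ℝ => x ^ (n + 1)) 0 := by fun_prop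
    simpa [ContinuousAt] using this.tendsto.mono_left nhdsWithin_le_nhds
  exact tendsto_nhds_unique (hP.tendsto.mono_left nhdsWithin_le_nhds) (h.trans_tendsto h1)

theorem isBigO_pow_succ_cancel {c : ℝ} {P : ℝ → ℝ} {n : ℕ} (hP : ContinuousAt P 0)
    (h : (fun x => c + x * P x) =O[𝓝[≠] 0] fun x : ℝ => x ^ (n + 1)) :
    c = 0 ∧ P =O[𝓝[≠] 0] fun x : ℝ => x ^ n := by
  have hc : c = 0 := by
    simpa using ContinuousAt.eq_zero_of_isBigO_pow (P := fun x => c + x * P x) (by fun_prop) h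
  refine ⟨hc, ?_⟩
  subst hc
  obtain ⟨C, hC⟩ := h.bound
  refine IsBigO.of_bound C ?_
  filter_upwards [hC, self_mem_nhdsWithin] with x hx hx0
  have hx0' : 0 < ‖x‖ := norm_pos_iff.2 hx0
  rw [zero_add, norm_mul, pow_succ', norm_mul] at hx
  refine le_of_mul_le_mul_left ?_ hx0'
  linarith

/-- A cubic polynomial that is a big O of `x ^ 4` at the origin vanishes. -/
theorem cubic_coeff_eq_zero {k₀ k₁ k₂ k₃ : ℝ}
    (h : (fun x => k₀ + k₁ * x + k₂ * x ^ 2 + k₃ * x ^ 3) =O[𝓝[≠] 0] fun x : ℝ => x ^ 4) :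
    k₀ = 0 ∧ k₁ = 0 ∧ k₂ = 0 ∧ k₃ = 0 := by
  obtain ⟨h₀, h⟩ := isBigO_pow_succ_cancel (c := k₀)
    (P := fun x => k₁ + x * (k₂ + x * (k₃ + x * 0))) (n := 3) (by fun_prop)
    (h.congr_left fun x => by ring)
  obtain ⟨h₁, h⟩ := isBigO_pow_succ_cancel (by fun_prop) h
  obtain ⟨h₂, h⟩ := isBigO_pow_succ_cancel (by fun_prop) h
  obtain ⟨h₃, -⟩ := isBigO_pow_succ_cancel (by fun_prop) h
  exact ⟨h₀, h₁, h₂, h₃⟩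

theorem isBigO_of_cube_mul_le {K : ℝ × ℝ → ℝ} (hK : ContDiff ℝ ∞ K) {C : ℝ}
    (h : ∀ᶠ z : ℝ × ℝ in 𝓝 0, |z.2 ^ 3 * K z| ≤ C * |z.1| ^ 4) :
    (fun x => K (x, 0)) =O[𝓝 0] fun x : ℝ => x ^ 4 := by
  obtain ⟨g₁, hg₁, h₁⟩ := hK.exists_eq_add_fst_mul
  obtain ⟨g₂, hg₂, h₂⟩ := hg₁.exists_eq_add_fst_mul
  obtain ⟨g₃, hg₃, h₃⟩ := hg₂.exists_eq_add_fst_mul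
  obtain ⟨g₄, hg₄, h₄⟩ := hg₃.exists_eq_add_fst_mul
  have hexp : ∀ x y, K (x, y) = (K (0, y) + g₁ (0, y) * x + g₂ (0, y) * x ^ 2 +
      g₃ (0, y) * x ^ 3) + x ^ 4 * g₄ (x, y) := by
    intro x y
    rw [h₁, h₂, h₃, h₄]
    ring
  have hrem : ∀ y, (fun x => x ^ 4 * g₄ (x, y)) =O[𝓝 0] fun x : ℝ => x ^ 4 := by
    intro y
    have hb : (fun x => g₄ (x, y)) =O[𝓝 0] fun _ : ℝ => (1:ℝ) :=
      (hg₄.continuous.comp (by fun_prop : Continuous fun x : ℝ => (x, y))).continuousAt.isBigO_one ℝ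
    simpa using (isBigO_refl (fun x : ℝ => x ^ 4) (𝓝 0)).mul hb
  have hzero : ∀ᶠ y in 𝓝[≠] (0:ℝ), K (0, y) = 0 ∧ g₁ (0, y) = 0 ∧ g₂ (0, y) = 0 ∧
      g₃ (0, y) = 0 := by
    rw [← Prod.mk_zero_zero, nhds_prod_eq, eventually_swap_iff] at h
    filter_upwards [h.curry.filter_mono nhdsWithin_le_nhds, self_mem_nhdsWithin] with y hy hy0
    have hy0' : (0:ℝ) < |y ^ 3| := abs_pos.2 (pow_ne_zero 3 hy0)
    have hb : (fun x => K (x, y)) =O[𝓝 0] fun x : ℝ => x ^ 4 := by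
      refine IsBigO.of_bound (C / |y ^ 3|) ?_
      filter_upwards [hy] with x hx
      rw [Prod.swap_prod_mk, abs_mul] at hx
      rw [norm_pow, Real.norm_eq_abs, Real.norm_eq_abs, div_mul_eq_mul_div, le_div_iff₀ hy0']
      linarith
    refine cubic_coeff_eq_zero (((hb.sub (hrem y)).congr_left fun x => ?_).mono
      nhdsWithin_le_nhds)
    rw [hexp]
    ring
  have hcont : ∀ {u : ℝ × ℝ → ℝ}, Continuous u → (∀ᶠ y in 𝓝[≠] (0:ℝ), u (0, y) = 0) →
      u (0, 0) = 0 := by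
    intro u hu hy
    have h1 : Tendsto (fun y => u (0, y)) (𝓝[≠] 0) (𝓝 (u (0, 0))) :=
      ((hu.comp (by fun_prop : Continuous fun y : ℝ => ((0:ℝ), y))).tendsto 0).mono_left
        nhdsWithin_le_nhds
    exact tendsto_nhds_unique (h1.congr' hy) tendsto_const_nhds
  refine (hrem 0).congr_left fun x => ?_
  rw [hexp x 0, hcont hK.continuous (hzero.mono fun y hy => hy.1),
    hcont hg₁.continuous (hzero.mono fun y hy => hy.2.1),
    hcont hg₂.continuous (hzero.mono fun y hy => hy.2.2.1),
    hcont hg₃.continuous (hzero.mono fun y hy => hy.2.2.2)]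
  ring

theorem isBigO_minor {f₁ f₂ : ℝ × ℝ → ℝ} (hf₁ : ContDiff ℝ ∞ f₁) (hf₂ : ContDiff ℝ ∞ f₂)
    {d₁ d₂ : ℝ → ℝ → ℝ} {s₁ s₂ : ℝ → ℝ}
    (hd₁ : ∀ x y, HasDerivAt (fun y => f₁ (x, y)) (d₁ x y) y)
    (hd₂ : ∀ x y, HasDerivAt (fun y => f₂ (x, y)) (d₂ x y) y)
    (hs₁ : ∀ x, HasDerivAt (d₁ x) (s₁ x) 0) (hs₂ : ∀ x, HasDerivAt (d₂ x) (s₂ x) 0) {C : ℝ}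
    (h : ∀ᶠ z : ℝ × ℝ in 𝓝 0,
      |(f₁ z - f₁ (z.1, 0)) * (f₂ (z.1, 2 * z.2) - f₂ (z.1, 0)) -
        (f₁ (z.1, 2 * z.2) - f₁ (z.1, 0)) * (f₂ z - f₂ (z.1, 0))| ≤ C * |z.1| ^ 4) :
    (fun x => d₁ x 0 * s₂ x - d₂ x 0 * s₁ x) =O[𝓝 0] fun x : ℝ => x ^ 4 := by
  obtain ⟨p₁, q₁, r₁, hp₁, hq₁, hr₁, e₁⟩ := hf₁.exists_taylor_snd
  obtain ⟨p₂, q₂, r₂, hp₂, hq₂, hr₂, e₂⟩ := hf₂.exists_taylor_snd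
  have k₁ := fun x => deriv_of_taylor (φ := fun y => f₁ (x, y)) (r := fun y => r₁ (x, y))
    (by fun_prop) (e₁ x) (hd₁ x) (hs₁ x)
  have k₂ := fun x => deriv_of_taylor (φ := fun y => f₂ (x, y)) (r := fun y => r₂ (x, y))
    (by fun_prop) (e₂ x) (hd₂ x) (hs₂ x)
  have hK := isBigO_of_cube_mul_le (C := C) (K := fun z =>
    2 * (p₁ z.1 * q₂ z.1 - p₂ z.1 * q₁ z.1) +
    z.2 * (8 * p₁ z.1 * r₂ (z.1, 2 * z.2) + 2 * r₁ z * p₂ z.1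
      - 8 * p₂ z.1 * r₁ (z.1, 2 * z.2) - 2 * r₂ z * p₁ z.1) +
    z.2 ^ 2 * (8 * q₁ z.1 * r₂ (z.1, 2 * z.2) + 4 * r₁ z * q₂ z.1
      - 8 * q₂ z.1 * r₁ (z.1, 2 * z.2) - 4 * r₂ z * q₁ z.1) +
    z.2 ^ 3 * (8 * r₁ z * r₂ (z.1, 2 * z.2) - 8 * r₂ z * r₁ (z.1, 2 * z.2)))
    (by fun_prop) ?_
  · refine hK.congr_left fun x => ?_
    rw [(k₁ x).1, (k₁ x).2, (k₂ x).1, (k₂ x).2]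
    ring
  · filter_upwards [h] with z hz
    refine le_of_eq_of_le ?_ hz
    congr 1
    obtain ⟨x, y⟩ := z
    simp only
    rw [e₁ x y, e₂ x y, e₁ x (2 * y), e₂ x (2 * y)]
    ring

theorem cubic_coeff_of_horizontal {k a b aa ab bb k' a' b' aa' ab' bb' : ℝ} {κ : ℝ → ℝ} (l : ℝ)
    (hκ : ContinuousAt κ 0) (hκ0 : κ 0 = 4 / 3)
    (h : ∀ u v : ℝ → ℝ, (∀ x, u x = -2 * l * x) → (∀ x, v x = x * (-2 + x ^ 2 * κ x)) →
      (fun x => u x * (1 + (k' + a' * u x + b' * v x + aa' * u x ^ 2 + ab' * (u x * v x) +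
          bb' * v x ^ 2)) -
        (2 * u x + (k + a * u x + b * v x + aa * u x ^ 2 + ab * (u x * v x) + bb * v x ^ 2)))
        =O[𝓝 0] fun x : ℝ => x ^ 4) :
    -2 * l * (4 * l ^ 2 * aa' + 4 * l * ab' + 4 * bb') - 4 / 3 * b = 0 := by
  have h := (h _ _ (fun _ => rfl) (fun _ => rfl)).mono (nhdsWithin_le_nhds (s := {0}ᶜ))
  obtain ⟨-, h⟩ := isBigO_pow_succ_cancel (c := -k) (n := 3)
    (P := fun x => (-2 * l * (k' - 1 - a) + 2 * b) + x * ((-2 * l * (-2 * l * a' - 2 * b') -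
      (4 * l ^ 2 * aa + 4 * l * ab + 4 * bb)) + x *
      (-b * κ x - 2 * l * (b' - ab) * (x * κ x) - bb * (-4 * (x * κ x) + x * (x * κ x) ^ 2)
        - 2 * l * (4 * l ^ 2 * aa' - 2 * l * ab' * (-2 + x ^ 2 * κ x) +
          bb' * (-2 + x ^ 2 * κ x) ^ 2))))
    (by fun_prop) (h.congr_left fun x => by ring)
  obtain ⟨-, h⟩ := isBigO_pow_succ_cancel (by fun_prop) h
  obtain ⟨-, h⟩ := isBigO_pow_succ_cancel (by fun_prop) h
  have := ContinuousAt.eq_zero_of_isBigO_pow (n := 0) (by fun_prop) h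
  simp only [hκ0] at this
  linear_combination this

theorem cubic_coeff_of_vertical {k b bb k' b' bb' : ℝ} {κ ς : ℝ → ℝ}
    (hκ : ContinuousAt κ 0) (hς : ContinuousAt ς 0) (hς0 : ς 0 = -(8 / 3))
    (h : ∀ v s : ℝ → ℝ, (∀ x, v x = x * (-2 + x ^ 2 * κ x)) → (∀ x, s x = x ^ 3 * ς x) →
      (fun x => v x * (1 + (k' + b' * v x + bb' * v x ^ 2)) -
        (s x + (k + b * v x + bb * v x ^ 2))) =O[𝓝 0] fun x : ℝ => x ^ 4) :
    bb' = 1 / 3 := by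
  have h := (h _ _ (fun _ => rfl) (fun _ => rfl)).mono (nhdsWithin_le_nhds (s := {0}ᶜ))
  obtain ⟨-, h⟩ := isBigO_pow_succ_cancel (c := -k) (n := 3)
    (P := fun x => -2 * (1 + k' - b) + x * (4 * (b' - bb) + x * ((1 + k' - b) * κ x +
      (b' - bb) * (-4 * (x * κ x) + x * (x * κ x) ^ 2) +
      (bb' * (-2 + x ^ 2 * κ x) ^ 3 - ς x))))
    (by fun_prop) (h.congr_left fun x => by ring)
  obtain ⟨h₁, h⟩ := isBigO_pow_succ_cancel (by fun_prop) h
  obtain ⟨-, h⟩ := isBigO_pow_succ_cancel (by fun_prop) h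
  have := ContinuousAt.eq_zero_of_isBigO_pow (n := 0) (by fun_prop) h
  have h₂ : 1 + k' - b = 0 := by linarith
  simp only [hς0, h₂] at this
  linarith

theorem exists_arctan_eq : ∃ ρ : ℝ → ℝ, ContinuousAt ρ 0 ∧ ρ 0 = -(1 / 3) ∧
    ∀ x, Real.arctan x = x + x ^ 3 * ρ x := by
  have hd : ∀ x, HasDerivAt (fun x => Real.arctan x - x + x ^ 3 / 3)
      (x ^ 4 / (1 + x ^ 2)) x := by
    intro x
    refine (((Real.hasDerivAt_arctan x).sub (hasDerivAt_id x)).add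
      (((hasDerivAt_id x).pow 3).div_const 3)).congr_deriv ?_
    have : 1 + x ^ 2 ≠ 0 := by positivity
    simp
    field_simp
    ring
  have hb : ∀ x, |Real.arctan x - x + x ^ 3 / 3| ≤ |x| ^ 5 := by
    intro x
    have := (convex_Icc (-|x|) |x|).norm_image_sub_le_of_norm_hasDerivWithin_le (C := |x| ^ 4)
      (fun y _ => (hd y).hasDerivWithinAt) (fun y hy => ?_) (x := 0) (y := x)
      ⟨by simp, by simp⟩ ⟨neg_abs_le x, le_abs_self x⟩
    · simpa [pow_succ] using this
    · have hy' : |y| ≤ |x| := abs_le.2 hy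
      rw [Real.norm_eq_abs, abs_div, abs_pow, abs_of_pos (by positivity : 0 < 1 + y ^ 2)]
      refine (div_le_self (by positivity) (by nlinarith [sq_nonneg y])).trans ?_
      gcongr
  refine ⟨fun x => if x = 0 then -(1 / 3) else (Real.arctan x - x) / x ^ 3, ?_, by simp, ?_⟩
  · refine continuousAt_of_tendsto_nhds (y := -(1 / 3)) (tendsto_iff_norm_sub_tendsto_zero.2 ?_)
    refine squeeze_zero (g := fun x : ℝ => |x| ^ 2) (fun _ => norm_nonneg _) (fun x => ?_) ?_
    · by_cases hx : x = 0
      · simp [hx]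
      · have hx' : 0 < |x ^ 3| := abs_pos.2 (pow_ne_zero 3 hx)
        rw [if_neg hx, Real.norm_eq_abs]
        have : (Real.arctan x - x) / x ^ 3 - -(1 / 3) =
            (Real.arctan x - x + x ^ 3 / 3) / x ^ 3 := by
          field_simp
          ring
        rw [this, abs_div, div_le_iff₀ hx', abs_pow, ← pow_add]
        exact hb x
    · have : ContinuousAt (fun x : ℝ => |x| ^ 2) 0 := by fun_prop
      simpa [ContinuousAt] using this
  · intro x
    by_cases hx : x = 0
    · simp [hx]
    · simp only [if_neg hx]
      field_simp
      ring

theorem abs_minor_le {a₁ a₂ b₁ b₂ A₁ A₂ B₁ B₂ M η : ℝ} (h : a₁ * b₂ = a₂ * b₁)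
    (ha₁ : |A₁ - a₁| ≤ η) (ha₂ : |A₂ - a₂| ≤ η) (hb₁ : |B₁ - b₁| ≤ η) (hb₂ : |B₂ - b₂| ≤ η)
    (hA₁ : |A₁| ≤ M) (hA₂ : |A₂| ≤ M) (hB₁ : |B₁| ≤ M) (hB₂ : |B₂| ≤ M) (hη : η ≤ 1) :
    |A₁ * B₂ - A₂ * B₁| ≤ (4 * M + 2) * η := by
  have hη0 : 0 ≤ η := (abs_nonneg _).trans ha₁
  have hM : 0 ≤ M := (abs_nonneg _).trans hA₁
  have e : A₁ * B₂ - A₂ * B₁ = (A₁ * (B₂ - b₂) + (A₁ - a₁) * B₂ - (A₁ - a₁) * (B₂ - b₂)) -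
      (A₂ * (B₁ - b₁) + (A₂ - a₂) * B₁ - (A₂ - a₂) * (B₁ - b₁)) := by
    linear_combination h
  have t : ∀ x y p q : ℝ, |x| ≤ p → |y| ≤ q → |x * y| ≤ p * q := fun x y p q hx hy => by
    rw [abs_mul]
    exact mul_le_mul hx hy (abs_nonneg _) ((abs_nonneg _).trans hx)
  have t₁ := abs_le.1 (t _ _ _ _ hA₁ hb₂)
  have t₂ := abs_le.1 (t _ _ _ _ ha₁ hB₂)
  have t₃ := abs_le.1 (t _ _ _ _ ha₁ hb₂)
  have t₄ := abs_le.1 (t _ _ _ _ hA₂ hb₁)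
  have t₅ := abs_le.1 (t _ _ _ _ ha₂ hB₁)
  have t₆ := abs_le.1 (t _ _ _ _ ha₂ hb₁)
  rw [e, abs_le]
  constructor <;> nlinarith

/-- The tan-example curves through a common point, written in a frame `e`; `z.1` is the size of the
parameter and `exp z.2` is the time. -/
def tanCurve {E : Type} [NormedAddCommGroup E] [NormedSpace ℝ E] (e : Fin 3 → E) (l : ℝ)
    (z : ℝ × ℝ) : E :=
  (l * z.1 * (1 - Real.exp z.2 ^ 2)) • e 0 +
    (Real.arctan (z.1 * Real.exp (-z.2)) - Real.exp z.2 * Real.arctan z.1) • e 1 +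
    Real.exp z.2 • e 2

section tanCurve

variable {E : Type} [NormedAddCommGroup E] [NormedSpace ℝ E]

theorem contDiff_tanCurve (e : Fin 3 → E) (l : ℝ) : ContDiff ℝ ∞ (tanCurve e l) := by
  have h : ContDiff ℝ ∞ Real.arctan := Real.contDiff_arctan
  have h₁ : ContDiff ℝ ∞ fun z : ℝ × ℝ => Real.arctan (z.1 * Real.exp (-z.2)) :=
    h.comp (by fun_prop)
  have h₂ : ContDiff ℝ ∞ fun z : ℝ × ℝ => Real.arctan z.1 := h.comp (by fun_prop)
  unfold tanCurve
  fun_prop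

theorem tanCurve_zero_right (e : Fin 3 → E) (l x : ℝ) : tanCurve e l (x, 0) = e 2 := by
  simp [tanCurve]

/-- The velocity of `tanCurve`. -/
def tanVelocity (e : Fin 3 → E) (l x y : ℝ) : E :=
  (-2 * l * x * Real.exp y ^ 2) • e 0 +
    (-(x * Real.exp (-y)) / (1 + (x * Real.exp (-y)) ^ 2) - Real.exp y * Real.arctan x) • e 1 +
    Real.exp y • e 2

/-- The acceleration of `tanCurve` at the common point. -/
def tanAccel (e : Fin 3 → E) (l x : ℝ) : E :=
  (-4 * l * x) • e 0 + (x * (1 - x ^ 2) / (1 + x ^ 2) ^ 2 - Real.arctan x) • e 1 + e 2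

theorem hasDerivAt_mul_exp_neg (x y : ℝ) :
    HasDerivAt (fun y => x * Real.exp (-y)) (-(x * Real.exp (-y))) y := by
  simpa using ((hasDerivAt_neg y).exp).const_mul x

theorem hasDerivAt_tanCurve (e : Fin 3 → E) (l x y : ℝ) :
    HasDerivAt (fun y => tanCurve e l (x, y)) (tanVelocity e l x y) y := by
  refine ((((((Real.hasDerivAt_exp y).pow 2).const_sub 1).const_mul (l * x)).smul_const
    (e 0)).add ((((hasDerivAt_mul_exp_neg x y).arctan).sub
    ((Real.hasDerivAt_exp y).mul_const (Real.arctan x))).smul_const (e 1))).add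
    ((Real.hasDerivAt_exp y).smul_const (e 2)) |>.congr_deriv ?_
  rw [tanVelocity]
  congr 3
  · simp
    ring
  · ring

theorem hasDerivAt_tanVelocity (e : Fin 3 → E) (l x : ℝ) :
    HasDerivAt (tanVelocity e l x) (tanAccel e l x) 0 := by
  have h := hasDerivAt_mul_exp_neg x 0
  have hne : 1 + (x * Real.exp (-0)) ^ 2 ≠ 0 := by positivity
  refine ((((((Real.hasDerivAt_exp 0).pow 2).const_mul (-2 * l * x)).smul_const
    (e 0)).add (((h.neg.div ((h.pow 2).const_add 1) hne).sub
    ((Real.hasDerivAt_exp 0).mul_const (Real.arctan x))).smul_const (e 1))).add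
    ((Real.hasDerivAt_exp 0).smul_const (e 2))) |>.congr_deriv ?_
  rw [tanAccel]
  simp only [neg_zero, Real.exp_zero, one_smul, mul_one, one_mul]
  congr 3
  · simp
    ring
  · simp
    ring

/-- The curves `tanCurve e l` cannot be straightened to fourth order by functions `g` whose
differentials at the common point are dual to the frame. -/
theorem false_of_tanCurve_minor_le {e : Fin 3 → E} {g : Fin 3 → E → ℝ}
    (hg : ∀ i, ContDiff ℝ ∞ (g i))
    (hdual : ∀ i j, fderiv ℝ (g i) (e 2) (e j) = if i = j then 1 else 0)
    (h : ∀ l i j, ∃ C, ∀ᶠ z : ℝ × ℝ in 𝓝 0,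
      |(g i (tanCurve e l z) - g i (tanCurve e l (z.1, 0))) *
          (g j (tanCurve e l (z.1, 2 * z.2)) - g j (tanCurve e l (z.1, 0))) -
        (g i (tanCurve e l (z.1, 2 * z.2)) - g i (tanCurve e l (z.1, 0))) *
          (g j (tanCurve e l z) - g j (tanCurve e l (z.1, 0)))| ≤ C * |z.1| ^ 4) : False := by
  have hd : ∀ i, ContDiff ℝ ∞ (fderiv ℝ (g i)) := fun i => (hg i).fderiv_right (by simp)
  have hv : ∀ l x, tanVelocity e l x 0 = (-2 * l * x) • e 0 +
      (-x / (1 + x ^ 2) - Real.arctan x) • e 1 + e 2 := by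
    intro l x
    simp [tanVelocity]
  set Q : Fin 3 → Fin 3 → Fin 3 → ℝ :=
    fun i j k => fderiv ℝ (fderiv ℝ (g i)) (e 2) (e j) (e k) with hQ
  have h₁ : ∀ i l x y, HasDerivAt (fun y => g i (tanCurve e l (x, y)))
      (fderiv ℝ (g i) (tanCurve e l (x, y)) (tanVelocity e l x y)) y := fun i l x y =>
    ((hg i).differentiable (by simp) _).hasFDerivAt.comp_hasDerivAt y
      (hasDerivAt_tanCurve e l x y)
  have h₂ : ∀ i l x, HasDerivAt
      (fun y => fderiv ℝ (g i) (tanCurve e l (x, y)) (tanVelocity e l x y))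
      (fderiv ℝ (fderiv ℝ (g i)) (e 2) (tanVelocity e l x 0) (tanVelocity e l x 0) +
        fderiv ℝ (g i) (e 2) (tanAccel e l x)) 0 := fun i l x => by
    have := ((((hd i).differentiable (by simp) _).hasFDerivAt.comp_hasDerivAt 0
      (hasDerivAt_tanCurve e l x 0)).clm_apply (hasDerivAt_tanVelocity e l x))
    simpa only [Function.comp_apply, tanCurve_zero_right] using this
  have hO : ∀ l i j, _ := fun l i j =>
    (h l i j).elim fun C hC => isBigO_minor ((hg i).comp (contDiff_tanCurve e l))
      ((hg j).comp (contDiff_tanCurve e l)) (h₁ i l) (h₁ j l) (h₂ i l) (h₂ j l) hC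
  simp only [hv, tanAccel, tanCurve_zero_right, map_add, map_smul, hdual,
    add_apply, smul_apply, smul_eq_mul] at hO
  obtain ⟨ρ, hρ, hρ0, hρx⟩ := exists_arctan_eq
  have hu : ∀ x : ℝ, 1 + x ^ 2 ≠ 0 := fun x => by positivity
  have hX := fun l => cubic_coeff_of_horizontal (κ := fun x => (1 + x ^ 2)⁻¹ - ρ x)
    (k := Q 0 2 2) (a := Q 0 0 2 + Q 0 2 0) (b := Q 0 1 2 + Q 0 2 1)
    (aa := Q 0 0 0) (ab := Q 0 0 1 + Q 0 1 0) (bb := Q 0 1 1)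
    (k' := Q 2 2 2) (a' := Q 2 0 2 + Q 2 2 0) (b' := Q 2 1 2 + Q 2 2 1)
    (aa' := Q 2 0 0) (ab' := Q 2 0 1 + Q 2 1 0) (bb' := Q 2 1 1) l
    (by fun_prop (disch := simp)) (by simp [hρ0]; norm_num) (fun u v hu' hv' => by
      refine (hO l 0 2).congr_left fun x => ?_
      have ev : v x = -x / (1 + x ^ 2) - Real.arctan x := by
        have := hu x
        rw [hv', hρx]
        field_simp
        ring
      rw [← ev, ← hu']
      simp [hQ]
      rw [show -(4 * l * x) = 2 * u x by rw [hu']; ring]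
      ring)
  have hY := cubic_coeff_of_vertical (κ := fun x => (1 + x ^ 2)⁻¹ - ρ x)
    (ς := fun x => -(3 + x ^ 2) * ((1 + x ^ 2)⁻¹) ^ 2 - ρ x)
    (k := Q 1 2 2) (b := Q 1 1 2 + Q 1 2 1) (bb := Q 1 1 1)
    (k' := Q 2 2 2) (b' := Q 2 1 2 + Q 2 2 1) (bb' := Q 2 1 1)
    (by fun_prop (disch := simp)) (by fun_prop (disch := simp)) (by simp [hρ0]; norm_num)
    (fun v s hv' hs' => by
      refine (hO 0 1 2).congr_left fun x => ?_
      have ev : v x = -x / (1 + x ^ 2) - Real.arctan x := by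
        have := hu x
        rw [hv', hρx]
        field_simp
        ring
      have es : s x = x * (1 - x ^ 2) / (1 + x ^ 2) ^ 2 - Real.arctan x := by
        have := hu x
        rw [hs', hρx]
        field_simp
        ring
      rw [← ev, ← es]
      simp [hQ]
      ring)
  linarith [hX 0, hX 1, hX (-1), hX 2]

end tanCurve

/-- A function that is smooth on a ball agrees near the center with a globally smooth function. -/
theorem ContDiffOn.exists_contDiff_eventuallyEq {E F : Type} [NormedAddCommGroup E]
    [NormedSpace ℝ E] [HasContDiffBump E] [NormedAddCommGroup F] [NormedSpace ℝ F] {f : E → F}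
    {c : E} {r : ℝ} (hr : 0 < r) (hf : ContDiffOn ℝ ∞ f (ball c r)) :
    ∃ g : E → F, ContDiff ℝ ∞ g ∧ g =ᶠ[𝓝 c] f := by
  let χ : ContDiffBump c := ⟨r / 4, r / 2, by positivity, by linarith⟩
  refine ⟨fun x => χ x • f x, contDiff_iff_contDiffAt.2 fun x => ?_, ?_⟩
  · by_cases hx : x ∈ ball c r
    · exact χ.contDiffAt.smul (hf.contDiffAt (isOpen_ball.mem_nhds hx))
    · have hx' : x ∉ tsupport χ := by
        rw [χ.tsupport_eq]
        exact fun h => hx (closedBall_subset_ball (by simp [χ]; linarith) h)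
      refine (contDiffAt_const (c := (0 : F))).congr_of_eventuallyEq ?_
      filter_upwards [notMem_tsupport_iff_eventuallyEq.1 hx'] with y hy
      simp [hy]
  · filter_upwards [χ.eventuallyEq_one] with x hx
    simp [hx]

/-- Parameters of curves `ellTan` through the common base point. -/
def baseParam (m : ℕ) (l x : ℝ) : (Fin (m+2) → ℝ) × (Fin (m+2) → ℝ) :=
  ((l * x) • Pi.single 0 1 + Real.arctan x • Pi.single (Fin.last (m+1)) 1,
    (l * x) • Pi.single 0 1 + x • Pi.single (Fin.last (m+1)) 1)

theorem continuous_baseParam (m : ℕ) (l : ℝ) : Continuous (baseParam m l) := by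
  have := Real.continuous_arctan
  unfold baseParam
  fun_prop

theorem norm_baseParam_le (m : ℕ) (l x : ℝ) : ‖baseParam m l x‖ ≤ (|l| + 1) * |x| := by
  have h : ∀ y : ℝ, |y| ≤ |x| → ‖(l * x) • (Pi.single 0 1 : Fin (m+2) → ℝ) +
      y • (Pi.single (Fin.last (m+1)) 1 : Fin (m+2) → ℝ)‖ ≤ (|l| + 1) * |x| := by
    intro y hy
    refine (norm_add_le _ _).trans ?_
    rw [norm_smul, norm_smul, Pi.norm_single, Pi.norm_single]
    simp only [Real.norm_eq_abs, abs_mul, abs_one, mul_one]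
    linarith
  have hx : |Real.arctan x| ≤ |x| := by
    have := (convex_univ (𝕜 := ℝ) (E := ℝ)).norm_image_sub_le_of_norm_hasDerivWithin_le (C := 1)
      (fun y _ => (Real.hasDerivAt_arctan y).hasDerivWithinAt) (fun y _ => ?_) (mem_univ 0)
      (mem_univ x)
    · simpa using this
    · rw [Real.norm_eq_abs, abs_of_pos (by positivity)]
      exact div_le_self zero_le_one (by nlinarith [sq_nonneg y])
  exact max_le (h _ hx) (h _ le_rfl)

/-- Coordinate positions of `x₁`, `x_{n-1}` and `t`. -/
def frameIndex (m : ℕ) : Fin 3 → Fin (m+3) :=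
  ![0, ⟨m+1, by omega⟩, Fin.last (m+2)]

theorem frameIndex_injective (m : ℕ) : Function.Injective (frameIndex m) := by
  intro i j h
  fin_cases i <;> fin_cases j <;> simp_all [frameIndex, Fin.ext_iff]

/-- The coordinate frame along `frameIndex`. -/
def coordFrame (m : ℕ) (i : Fin 3) : Fin (m+3) → ℝ :=
  Pi.single (frameIndex m i) 1

theorem coordFrame_two (m : ℕ) : coordFrame m 2 = toPt (m+3) (fun _ => (0:ℝ)) 1 := by
  ext i
  by_cases h : (i : ℕ) < m + 2
  · have : i ≠ Fin.last (m+2) := Fin.ne_of_lt h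
    simp [coordFrame, frameIndex, toPt, h, this]
  · have : i = Fin.last (m+2) := Fin.ext (by simp; omega)
    simp [coordFrame, frameIndex, toPt, this]

theorem tanCurve_coordFrame (m : ℕ) (l : ℝ) (z : ℝ × ℝ) :
    tanCurve (coordFrame m) l z = toPt (m+3)
      (xsolTan m (baseParam m l z.1).1 (baseParam m l z.1).2 (Real.exp z.2)) (Real.exp z.2) := by
  have hm : m + 1 < m + 3 := by omega
  ext i
  by_cases h : (i : ℕ) < m + 2
  · by_cases h' : (i : ℕ) < m + 1
    · by_cases h₀ : i = 0
      · subst h₀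
        simp [tanCurve, coordFrame, frameIndex, toPt, xsolTan, baseParam, Fin.ext_iff]
        ring
      · have h₀' : (i : ℕ) ≠ 0 := fun hi => h₀ (Fin.ext hi)
        have h₁ : (i : ℕ) ≠ m + 1 := h'.ne
        have h₂ : (i : ℕ) ≠ m + 2 := h.ne
        simp [tanCurve, coordFrame, frameIndex, toPt, xsolTan, baseParam, Fin.ext_iff,
          h, h', h₀', h₁, h₂]
    · obtain rfl : i = ⟨m + 1, hm⟩ := Fin.ext (by simp; omega)
      simp [tanCurve, coordFrame, frameIndex, toPt, xsolTan, baseParam, Fin.ext_iff,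
          Pi.single_apply, Real.exp_neg, div_eq_mul_inv]
  · obtain rfl : i = Fin.last (m+2) := Fin.ext (by simp; omega)
    simp [tanCurve, coordFrame, frameIndex, toPt, Fin.ext_iff]

/-- Differences of points that are close to a common line are nearly parallel. -/
theorem minor_le_of_dist_lineSet_le {n : ℕ} {ξ v : Fin (n-1) → ℝ} {ℓ ℓ' : (Fin n → ℝ) →L[ℝ] ℝ}
    {y₀ y₁ y₂ : Fin n → ℝ} {δ N M : ℝ} (hℓ : ‖ℓ‖ ≤ N) (hℓ' : ‖ℓ'‖ ≤ N) (hδ : 2 * N * δ ≤ 1)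
    (h₀ : ∃ q ∈ lineSet n ξ v, dist y₀ q ≤ δ) (h₁ : ∃ q ∈ lineSet n ξ v, dist y₁ q ≤ δ)
    (h₂ : ∃ q ∈ lineSet n ξ v, dist y₂ q ≤ δ) (b₀ : |ℓ y₀| ≤ M) (b₁ : |ℓ y₁| ≤ M)
    (b₂ : |ℓ y₂| ≤ M) (b₀' : |ℓ' y₀| ≤ M) (b₁' : |ℓ' y₁| ≤ M) (b₂' : |ℓ' y₂| ≤ M) :
    |(ℓ y₁ - ℓ y₀) * (ℓ' y₂ - ℓ' y₀) - (ℓ y₂ - ℓ y₀) * (ℓ' y₁ - ℓ' y₀)| ≤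
      (4 * (2 * M) + 2) * (2 * N * δ) := by
  obtain ⟨q₀, ⟨s₀, rfl⟩, h₀⟩ := h₀
  obtain ⟨q₁, ⟨s₁, rfl⟩, h₁⟩ := h₁
  obtain ⟨q₂, ⟨s₂, rfl⟩, h₂⟩ := h₂
  set D := toPt n ξ 1
  have hM : ∀ a b : ℝ, |a| ≤ M → |b| ≤ M → |a - b| ≤ 2 * M := fun a b ha hb =>
    (abs_sub a b).trans (by linarith)
  have key : ∀ (f : (Fin n → ℝ) →L[ℝ] ℝ), ‖f‖ ≤ N → ∀ y s,
      dist y (toPt n v 0 - s • D) ≤ δ → |f y - f y₀ - (s₀ - s) * f D| ≤ 2 * N * δ := by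
    intro f hf y s hy
    have e : f y - f y₀ - (s₀ - s) * f D =
        f ((y - (toPt n v 0 - s • D)) - (y₀ - (toPt n v 0 - s₀ • D))) := by
      simp only [map_sub, map_smul, smul_eq_mul]
      ring
    rw [e, ← Real.norm_eq_abs]
    rw [dist_eq_norm] at hy h₀
    refine (f.le_opNorm _).trans ?_
    have hn := norm_sub_le (y - (toPt n v 0 - s • D)) (y₀ - (toPt n v 0 - s₀ • D))
    calc ‖f‖ * _ ≤ N * (2 * δ) :=
          mul_le_mul hf (by linarith) (norm_nonneg _) ((norm_nonneg f).trans hf)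
      _ = 2 * N * δ := by ring
  exact abs_minor_le (a₁ := (s₀ - s₁) * ℓ D) (a₂ := (s₀ - s₂) * ℓ D) (b₁ := (s₀ - s₁) * ℓ' D)
    (b₂ := (s₀ - s₂) * ℓ' D) (by ring) (key ℓ hℓ y₁ s₁ h₁) (key ℓ hℓ y₂ s₂ h₂)
    (key ℓ' hℓ' y₁ s₁ h₁) (key ℓ' hℓ' y₂ s₂ h₂) (hM _ _ b₁ b₀) (hM _ _ b₂ b₀)
    (hM _ _ b₁' b₀') (hM _ _ b₂' b₀') hδ

theorem stmt14 (m : ℕ) (ε₀ : ℝ) (hε₀ : 0 < ε₀) :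
    ¬ ∃ (F Finv : (Fin (m+3) → ℝ) → (Fin (m+3) → ℝ))
        (Ξ V : (Fin (m+2) → ℝ) × (Fin (m+2) → ℝ) → (Fin (m+2) → ℝ))
        (C : ℝ) (U : Set ((Fin (m+2) → ℝ) × (Fin (m+2) → ℝ))),
      ContDiffOn ℝ (⊤ : ℕ∞) F (ball (toPt (m+3) (fun _ => (0:ℝ)) 1) ε₀) ∧
      InjOn F (ball (toPt (m+3) (fun _ => (0:ℝ)) 1) ε₀) ∧
      IsOpen (F '' ball (toPt (m+3) (fun _ => (0:ℝ)) 1) ε₀) ∧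
      ContDiffOn ℝ (⊤ : ℕ∞) Finv (F '' ball (toPt (m+3) (fun _ => (0:ℝ)) 1) ε₀) ∧
      (∀ y ∈ ball (toPt (m+3) (fun _ => (0:ℝ)) 1) ε₀, Finv (F y) = y) ∧
      0 < C ∧ U ∈ 𝓝 ((0, 0) : (Fin (m+2) → ℝ) × (Fin (m+2) → ℝ)) ∧
      ∀ p ∈ U, ∀ y ∈ F '' (ellTan m p.1 p.2 ∩ ball (toPt (m+3) (fun _ => (0:ℝ)) 1) ε₀),
        ∃ q ∈ lineSet (m+3) (Ξ p) (V p), dist y q ≤ C * ‖p‖^4 := by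
  rintro ⟨F, Finv, Ξ, V, C, U, hF, -, hopen, hFinv, hinv, hC, hU, hline⟩
  rw [← coordFrame_two] at hF hopen hFinv hinv hline
  set c := coordFrame m 2 with hc
  have hball : ball c ε₀ ∈ 𝓝 c := ball_mem_nhds c hε₀
  obtain ⟨G, hG, hGF⟩ := hF.exists_contDiff_eventuallyEq hε₀
  have hG' : HasFDerivAt F (fderiv ℝ G c) c :=
    (hG.differentiable (by simp) c).hasFDerivAt.congr_of_eventuallyEq hGF.symm
  have hB : HasFDerivAt Finv (fderiv ℝ Finv (F c)) (F c) :=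
    ((hFinv.contDiffAt (hopen.mem_nhds (mem_image_of_mem F (mem_of_mem_nhds hball)))
      ).differentiableAt (by simp)).hasFDerivAt
  set B := fderiv ℝ Finv (F c)
  have hBA : B.comp (fderiv ℝ G c) = ContinuousLinearMap.id ℝ _ :=
    (hB.comp c hG').unique ((hasFDerivAt_id c).congr_of_eventuallyEq
      (by filter_upwards [hball] with y hy using hinv y hy))
  let ℓ : Fin 3 → (Fin (m+3) → ℝ) →L[ℝ] ℝ := fun i =>
    (ContinuousLinearMap.proj (frameIndex m i)).comp B
  refine false_of_tanCurve_minor_le (e := coordFrame m) (g := fun i x => ℓ i (G x))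
    (fun i => (ℓ i).contDiff.comp hG) (fun i j => ?_) (fun l i j => ?_)
  · have h := ((ℓ i).hasFDerivAt.comp c (hG.differentiable (by simp) c).hasFDerivAt).fderiv
    have h' : B (fderiv ℝ G c (coordFrame m j)) = coordFrame m j :=
      congrArg (fun f => f (coordFrame m j)) hBA
    change fderiv ℝ (ℓ i ∘ G) c (coordFrame m j) = _
    rw [h]
    change B (fderiv ℝ G c (coordFrame m j)) (frameIndex m i) = _
    rw [h', coordFrame, Pi.single_apply]
    simp only [(frameIndex_injective m).eq_iff]
  · set N := max ‖ℓ i‖ ‖ℓ j‖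
    set M := max (|ℓ i (G c)| + 1) (|ℓ j (G c)| + 1)
    have hγ : Continuous (tanCurve (coordFrame m) l) := (contDiff_tanCurve _ l).continuous
    have hγ0 : tanCurve (coordFrame m) l 0 = c := tanCurve_zero_right _ l 0
    have hbd : ∀ k, ∀ᶠ y in 𝓝 c, |ℓ k (G y)| ≤ |ℓ k (G c)| + 1 := fun k =>
      ((((ℓ k).continuous.comp hG.continuous).abs.tendsto c).eventually_lt_const
        (lt_add_one _)).mono fun _ h => h.le
    have hgood : ∀ᶠ y in 𝓝 c, y ∈ ball c ε₀ ∧ G y = F y ∧ |ℓ i (G y)| ≤ M ∧ |ℓ j (G y)| ≤ M := by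
      filter_upwards [hball, hGF, hbd i, hbd j] with y h₁ h₂ h₃ h₄
      exact ⟨h₁, h₂, h₃.trans (le_max_left _ _), h₄.trans (le_max_right _ _)⟩
    have htime : ∀ᶠ z : ℝ × ℝ in 𝓝 0, |Real.exp z.2 - 1| ≤ 1 / 10 := by
      have : Continuous fun z : ℝ × ℝ => |Real.exp z.2 - 1| := by fun_prop
      exact ((this.tendsto 0).eventually_lt_const (by simp)).mono fun _ h => h.le
    have hz : ∀ᶠ z : ℝ × ℝ in 𝓝 0, |Real.exp z.2 - 1| ≤ 1 / 10 ∧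
        tanCurve (coordFrame m) l z ∈ ball c ε₀ ∧
        G (tanCurve (coordFrame m) l z) = F (tanCurve (coordFrame m) l z) ∧
        |ℓ i (G (tanCurve (coordFrame m) l z))| ≤ M ∧
        |ℓ j (G (tanCurve (coordFrame m) l z))| ≤ M :=
      htime.and ((hγ.tendsto' 0 c hγ0).eventually hgood)
    have hp : Continuous fun z : ℝ × ℝ => baseParam m l z.1 :=
      (continuous_baseParam m l).comp continuous_fst
    have hp0 : baseParam m l (0 : ℝ × ℝ).1 = (0, 0) := by simp [baseParam]
    have hU' : ∀ᶠ z : ℝ × ℝ in 𝓝 0, baseParam m l z.1 ∈ U := (hp.tendsto' 0 _ hp0).eventually hU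
    have hsmall : ∀ᶠ z : ℝ × ℝ in 𝓝 0, 2 * N * (C * ‖baseParam m l z.1‖ ^ 4) ≤ 1 := by
      have hcont : Continuous fun z : ℝ × ℝ => 2 * N * (C * ‖baseParam m l z.1‖ ^ 4) := by fun_prop
      refine ((hcont.tendsto 0).eventually_lt_const ?_).mono fun _ h => h.le
      rw [hp0]
      simp
    have t₀ : Tendsto (fun z : ℝ × ℝ => (z.1, (0:ℝ))) (𝓝 0) (𝓝 0) :=
      Continuous.tendsto' (by fun_prop) _ _ rfl
    have t₂ : Tendsto (fun z : ℝ × ℝ => (z.1, 2 * z.2)) (𝓝 0) (𝓝 0) :=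
      Continuous.tendsto' (by fun_prop) _ _ (by simp)
    refine ⟨(4 * (2 * M) + 2) * (2 * N * (C * (|l| + 1) ^ 4)), ?_⟩
    filter_upwards [hz, t₀.eventually hz, t₂.eventually hz, hU', hsmall] with z h₁ h₀ h₂ hzU hzs
    have near : ∀ y, |Real.exp y - 1| ≤ 1 / 10 → tanCurve (coordFrame m) l (z.1, y) ∈ ball c ε₀ →
        G (tanCurve (coordFrame m) l (z.1, y)) = F (tanCurve (coordFrame m) l (z.1, y)) →
        ∃ q ∈ lineSet (m+3) (Ξ (baseParam m l z.1)) (V (baseParam m l z.1)),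
          dist (G (tanCurve (coordFrame m) l (z.1, y))) q ≤ C * ‖baseParam m l z.1‖ ^ 4 := by
      intro y hy hyb hyG
      rw [hyG]
      exact hline _ hzU _ (mem_image_of_mem F
        ⟨⟨Real.exp y, hy, tanCurve_coordFrame m l (z.1, y)⟩, hyb⟩)
    refine (minor_le_of_dist_lineSet_le (le_max_left ‖ℓ i‖ ‖ℓ j‖) (le_max_right _ _) hzs
      (near 0 h₀.1 h₀.2.1 h₀.2.2.1) (near z.2 h₁.1 h₁.2.1 h₁.2.2.1)
      (near (2 * z.2) h₂.1 h₂.2.1 h₂.2.2.1) h₀.2.2.2.1 h₁.2.2.2.1 h₂.2.2.2.1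
      h₀.2.2.2.2 h₁.2.2.2.2 h₂.2.2.2.2).trans ?_
    have hM : 0 ≤ M := (abs_nonneg _).trans h₀.2.2.2.1
    have hN : 0 ≤ N := (norm_nonneg _).trans (le_max_left _ _)
    have hpow : ‖baseParam m l z.1‖ ^ 4 ≤ (|l| + 1) ^ 4 * |z.1| ^ 4 := by
      rw [← mul_pow]
      exact pow_le_pow_left₀ (norm_nonneg _) (norm_baseParam_le m l z.1) 4
    calc _ ≤ (4 * (2 * M) + 2) * (2 * N * (C * ((|l| + 1) ^ 4 * |z.1| ^ 4))) := by gcongr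
      _ = _ := by ring
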